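/- arXiv:2105.07765 — 2 statements merged into one kernel-verified Lean document; each statement's English description precedes it below -/
import Mathlib

section
/- Let p ≥ 1 be an integer, T : ℝ^n → ℝ a polynomial function of total degree at most p, σ > 0, and define m(s) := T(s) + (σ/(p+1)!) N(s)^{p+1}. Then m attains a global minimizer s* over ℝ^n; moreover every global minimizer s* satisfies m(s*) ≤ m(0) and, for every θ ≥ 1, ‖∇T(s*)‖_{N,1} ≤ θ (σ/p!) N(s*)^p. -/
open scoped RealInnerProductSpace

noncomputable section

/-- Abbreviation for the Euclidean space `ℝ^n`. -/
abbrev E (n : ℕ) := EuclideanSpace ℝ (Fin n)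

/-- `N` is a norm on `ℝ^n` (possibly non-smooth, e.g. `ℓ¹` or `ℓ∞`). -/
structure IsNorm (n : ℕ) (N : E n → ℝ) : Prop where
  add_le : ∀ x y, N (x + y) ≤ N x + N y
  smul : ∀ (c : ℝ) (x : E n), N (c • x) = |c| * N x
  eq_zero : ∀ x, N x = 0 → x = 0

/-- The dual norm `‖v‖_{N,1} := max_{N s = 1} ⟪v, s⟫`. -/
def dualNorm (n : ℕ) (N : E n → ℝ) (v : E n) : ℝ :=
  sSup {t : ℝ | ∃ s, N s = 1 ∧ t = ⟪v, s⟫}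

/-- The regularized model `m(t) = T(t) + (σ/(p+1)!) N(t)^{p+1}`. -/
def mreg (n p : ℕ) (N : E n → ℝ) (T : E n → ℝ) (σ : ℝ) (t : E n) : ℝ :=
  T t + σ / ((p + 1).factorial : ℝ) * N t ^ (p + 1)

namespace IsNorm

variable {n : ℕ} {N : E n → ℝ}

theorem zero (hN : IsNorm n N) : N 0 = 0 := by
  simpa using hN.smul 0 0

theorem neg (hN : IsNorm n N) (x : E n) : N (-x) = N x := by
  simpa using hN.smul (-1) x

theorem nonneg (hN : IsNorm n N) (x : E n) : 0 ≤ N x := by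
  have h := hN.add_le x (-x)
  rw [add_neg_cancel, hN.zero, hN.neg] at h
  linarith

theorem convexOn (hN : IsNorm n N) : ConvexOn ℝ Set.univ N := by
  refine ⟨convex_univ, fun x _ y _ a b ha hb _ => ?_⟩
  have h := hN.add_le (a • x) (b • y)
  rwa [hN.smul, hN.smul, abs_of_nonneg ha, abs_of_nonneg hb] at h

theorem continuous (hN : IsNorm n N) : Continuous N :=
  continuousOn_univ.1 (hN.convexOn.continuousOn isOpen_univ)

theorem exists_pos_mul_norm_le (hn : 1 ≤ n) (hN : IsNorm n N) :
    ∃ c : ℝ, 0 < c ∧ ∀ x, c * ‖x‖ ≤ N x := by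
  have : Nonempty (Fin n) := ⟨⟨0, hn⟩⟩
  obtain ⟨u, hu, hmin⟩ := (isCompact_sphere (0 : E n) 1).exists_isMinOn
    (NormedSpace.sphere_nonempty.2 zero_le_one) hN.continuous.continuousOn
  have hu1 : ‖u‖ = 1 := by simpa using hu
  have hu0 : N u ≠ 0 := fun h => by simp [hN.eq_zero u h] at hu1
  refine ⟨N u, (hN.nonneg u).lt_of_ne' hu0, fun x => ?_⟩
  rcases eq_or_ne x 0 with rfl | hx
  · simp [hN.zero]
  have hx' : 0 < ‖x‖ := norm_pos_iff.2 hx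
  have hmem : ‖x‖⁻¹ • x ∈ Metric.sphere (0 : E n) 1 := by
    simp [norm_smul, hx'.ne']
  have h : N u ≤ N (‖x‖⁻¹ • x) := hmin hmem
  rw [hN.smul, abs_of_pos (inv_pos.2 hx'), ← div_eq_inv_mul] at h
  exact (le_div_iff₀ hx').1 h

end IsNorm

theorem MvPolynomial.exists_abs_eval_le {n p : ℕ} (P : MvPolynomial (Fin n) ℝ)
    (hdeg : P.totalDegree ≤ p) :
    ∃ A : ℝ, 0 ≤ A ∧ ∀ x : E n, |P.eval (fun i => x i)| ≤ A * (1 + ‖x‖) ^ p := by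
  refine ⟨∑ d ∈ P.support, |P.coeff d|, Finset.sum_nonneg fun _ _ => abs_nonneg _, fun x => ?_⟩
  rw [MvPolynomial.eval_eq', Finset.sum_mul]
  refine (Finset.abs_sum_le_sum_abs _ _).trans (Finset.sum_le_sum fun d hd => ?_)
  rw [abs_mul, Finset.abs_prod]
  refine mul_le_mul_of_nonneg_left ?_ (abs_nonneg _)
  have hx : 1 ≤ 1 + ‖x‖ := by linarith [norm_nonneg x]
  have hd' : ∑ i, d i ≤ p := by
    have h := (MvPolynomial.le_totalDegree hd).trans hdeg
    rwa [Finsupp.sum_fintype _ _ fun _ => rfl] at h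
  calc ∏ i, |x i ^ d i| ≤ ∏ i, (1 + ‖x‖) ^ d i := by
        refine Finset.prod_le_prod (fun _ _ => abs_nonneg _) fun i _ => ?_
        rw [abs_pow]
        have h : |x i| ≤ ‖x‖ := PiLp.norm_apply_le x i
        exact pow_le_pow_left₀ (abs_nonneg _) (by linarith) _
    _ = (1 + ‖x‖) ^ ∑ i, d i := Finset.prod_pow_eq_pow_sum _ _ _
    _ ≤ (1 + ‖x‖) ^ p := pow_le_pow_right₀ hx hd'

theorem MvPolynomial.differentiable_eval {n : ℕ} (P : MvPolynomial (Fin n) ℝ) :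
    Differentiable ℝ fun x : E n => P.eval (fun i => x i) := by
  simp only [MvPolynomial.eval_eq']
  fun_prop

theorem tendsto_mreg_cocompact {n p : ℕ} (hn : 1 ≤ n) {N T : E n → ℝ}
    (hN : IsNorm n N) {A σ : ℝ} (hT : ∀ x, |T x| ≤ A * (1 + ‖x‖) ^ p) (hA : 0 ≤ A)
    (hσ : 0 < σ) :
    Filter.Tendsto (mreg n p N T σ) (Filter.cocompact (E n)) Filter.atTop := by
  obtain ⟨c, hc, hcN⟩ := hN.exists_pos_mul_norm_le hn
  set k : ℝ := σ / ((p + 1).factorial : ℝ) with hk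
  have hk0 : 0 < k := by positivity
  set a : ℝ := k * c ^ (p + 1) with ha
  have ha0 : 0 < a := by positivity
  have hlin : Filter.Tendsto (fun x : E n => a * ‖x‖ - A * 2 ^ p)
      (Filter.cocompact (E n)) Filter.atTop :=
    Filter.tendsto_atTop_add_const_right _ _
      ((tendsto_norm_cocompact_atTop (E := E n)).const_mul_atTop ha0)
  refine Filter.tendsto_atTop_mono' _ ?_ hlin
  filter_upwards [hlin.eventually_ge_atTop 0,
    (tendsto_norm_cocompact_atTop (E := E n)).eventually_ge_atTop 1] with x hx0 hx1
  have h1 : (c * ‖x‖) ^ (p + 1) ≤ N x ^ (p + 1) :=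
    pow_le_pow_left₀ (by positivity) (hcN x) _
  have h2 : (1 + ‖x‖) ^ p ≤ 2 ^ p * ‖x‖ ^ p := by
    rw [← mul_pow]
    exact pow_le_pow_left₀ (by positivity) (by linarith) _
  have h3 : -(A * (2 ^ p * ‖x‖ ^ p)) ≤ T x := by
    linarith [neg_abs_le (T x), hT x, mul_le_mul_of_nonneg_left h2 hA]
  have h4 : 1 ≤ ‖x‖ ^ p := one_le_pow₀ hx1
  calc a * ‖x‖ - A * 2 ^ p ≤ (a * ‖x‖ - A * 2 ^ p) * ‖x‖ ^ p := le_mul_of_one_le_right hx0 h4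
    _ = -(A * (2 ^ p * ‖x‖ ^ p)) + k * (c * ‖x‖) ^ (p + 1) := by rw [ha]; ring
    _ ≤ T x + k * N x ^ (p + 1) := add_le_add h3 (mul_le_mul_of_nonneg_left h1 hk0.le)

theorem inner_gradient_le_of_isMin {n p : ℕ} {N T : E n → ℝ} (hN : IsNorm n N) {σ : ℝ}
    (hσ : 0 < σ) {s : E n} (hT : DifferentiableAt ℝ T s)
    (hs : ∀ t, mreg n p N T σ s ≤ mreg n p N T σ t) {u : E n} (hu : N u = 1) :
    ⟪gradient T s, u⟫ ≤ σ / (p.factorial : ℝ) * N s ^ p := by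
  set k : ℝ := σ / ((p + 1).factorial : ℝ) with hk
  have hk0 : 0 < k := by positivity
  let f : ℝ → ℝ := fun t => T (s - t • u) + k * (N s + t) ^ (p + 1)
  have hline : HasDerivAt (fun t : ℝ => s - t • u) (-u) 0 := by
    simpa using ((hasDerivAt_id (0 : ℝ)).smul_const u).const_sub s
  have hTline : HasDerivAt (fun t : ℝ => T (s - t • u)) (-⟪gradient T s, u⟫) 0 := by
    have hT' : HasFDerivAt T (InnerProductSpace.toDual ℝ (E n) (gradient T s))
        (s - (0 : ℝ) • u) := by
      simpa using hT.hasGradientAt.hasFDerivAt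
    simpa [Function.comp_def] using hT'.comp_hasDerivAt (0 : ℝ) hline
  have hpow : HasDerivAt (fun t : ℝ => k * (N s + t) ^ (p + 1))
      (k * ((p + 1 : ℕ) * N s ^ p)) 0 := by
    simpa using ((((hasDerivAt_id (0 : ℝ)).const_add (N s)).pow (p + 1)).const_mul k)
  have hf : HasDerivAt f (-⟪gradient T s, u⟫ + k * ((p + 1 : ℕ) * N s ^ p)) 0 :=
    hTline.add hpow
  have hmin : IsLocalMinOn f (Set.Ici 0) 0 := by
    refine Filter.eventually_of_mem self_mem_nhdsWithin fun t ht => ?_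
    have ht' : 0 ≤ t := ht
    have h1 : N (s - t • u) ≤ N s + t := by
      have h := hN.add_le s (-(t • u))
      rwa [hN.neg, hN.smul, hu, abs_of_nonneg ht', mul_one, ← sub_eq_add_neg] at h
    have h2 : N (s - t • u) ^ (p + 1) ≤ (N s + t) ^ (p + 1) :=
      pow_le_pow_left₀ (hN.nonneg _) h1 _
    calc f 0 = mreg n p N T σ s := by simp [f, mreg, hk]
      _ ≤ mreg n p N T σ (s - t • u) := hs _
      _ ≤ f t := add_le_add le_rfl (mul_le_mul_of_nonneg_left h2 hk0.le)
  have hcone : (1 : ℝ) ∈ posTangentConeAt (Set.Ici (0 : ℝ)) 0 := by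
    refine mem_posTangentConeAt_of_segment_subset ((convex_Ici (0 : ℝ)).segment_subset ?_ ?_) <;>
      simp
  have h0 := hmin.hasFDerivWithinAt_nonneg hf.hasFDerivAt.hasFDerivWithinAt hcone
  have hfac : k * ((p + 1 : ℕ) * N s ^ p) = σ / (p.factorial : ℝ) * N s ^ p := by
    rw [hk, Nat.factorial_succ]
    push_cast
    field_simp
  rw [hfac] at h0
  simpa using h0

/-- if `T` is a polynomial of total degree at most `p` and `σ > 0`, then
`m(t) = T(t) + (σ/(p+1)!) N(t)^{p+1}` attains a global minimizer; every global minimizer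
`s*` satisfies `m(s*) ≤ m(0)` and, for all `θ ≥ 1`,
`‖∇T(s*)‖_{N,1} ≤ θ (σ/p!) N(s*)^p`. -/
theorem stmt3 {n : ℕ} (hn : 1 ≤ n) (N : E n → ℝ) (hN : IsNorm n N)
    (p : ℕ) (hp : 1 ≤ p) (T : E n → ℝ) (P : MvPolynomial (Fin n) ℝ)
    (hTP : ∀ x : E n, T x = MvPolynomial.eval (fun i => x i) P)
    (hdeg : P.totalDegree ≤ p) (σ : ℝ) (hσ : 0 < σ) :
    (∃ sstar : E n, ∀ t, mreg n p N T σ sstar ≤ mreg n p N T σ t) ∧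
      ∀ sstar : E n, (∀ t, mreg n p N T σ sstar ≤ mreg n p N T σ t) →
        mreg n p N T σ sstar ≤ mreg n p N T σ 0 ∧
          ∀ θ : ℝ, 1 ≤ θ →
            dualNorm n N (gradient T sstar) ≤ θ * (σ / (p.factorial : ℝ)) * N sstar ^ p := by
  have hTfun : T = fun x : E n => MvPolynomial.eval (fun i => x i) P := funext hTP
  have hdiff : Differentiable ℝ T := hTfun ▸ P.differentiable_eval
  refine ⟨?_, fun s hs => ⟨hs 0, fun θ hθ => ?_⟩⟩
  · obtain ⟨A, hA, hPA⟩ := P.exists_abs_eval_le hdeg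
    have hcont : Continuous (mreg n p N T σ) :=
      hdiff.continuous.add (continuous_const.mul (hN.continuous.pow _))
    exact hcont.exists_forall_le
      (tendsto_mreg_cocompact hn hN (fun x => hTP x ▸ hPA x) hA hσ)
  · have hpos : 0 ≤ σ / (p.factorial : ℝ) * N s ^ p := by
      have := pow_nonneg (hN.nonneg s) p
      positivity
    rw [mul_assoc]
    refine le_trans (Real.sSup_le ?_ hpos) (le_mul_of_one_le_left hpos hθ)
    rintro _ ⟨u, hu, rfl⟩
    exact inner_gradient_le_of_isMin hN hσ (hdiff s) hs hu
end
end

section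
/- Consider any AR1pGN run for a function f satisfying AS.1 with Lipschitz constant L_{r,p} and AS.2 with lower bound f_low, let ε₁ ∈ (0,1], and suppose that ‖∇f(x_j)‖_{N,1} > ε₁ for every j ∈ {0, …, k+1} (i.e. the termination test is not triggered up to iteration k+1). Then the number of successful iterations among {0, …, k}, i.e. #{ j ≤ k : ρ_j ≥ η₁ }, is at most ((p+1)!/(η₁ σ_min)) · ((L_{r,p} + θ₁ σ_max)/p!)^{(p+1)/p} · (f(x₀) − f_low) · ε₁^{−(p+1)/p}, where σ_max := γ₃ · max( σ₀, L_{r,p}/(1 − η₂) ). -/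
open scoped RealInnerProductSpace

noncomputable section

/-- The norm `‖S‖_{N,ℓ} := max_{N s = 1} |S[s,…,s]|` of an `ℓ`-linear form induced by `N`. -/
def tensorNorm (n p : ℕ) (N : E n → ℝ)
    (S : ContinuousMultilinearMap ℝ (fun _ : Fin p => E n) ℝ) : ℝ :=
  sSup {t : ℝ | ∃ s, N s = 1 ∧ t = |S (fun _ => s)|}

/-- The `p`-th order Taylor polynomial
`T_{f,p}(x,s) = f(x) + Σ_{ℓ=1}^p (1/ℓ!) ∇^ℓ f(x)[s]^ℓ`. -/
def Tay (n p : ℕ) (f : E n → ℝ) (x s : E n) : ℝ :=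
  f x + ∑ ℓ ∈ Finset.Icc 1 p, (1 / (ℓ.factorial : ℝ)) * iteratedFDeriv ℝ ℓ f x (fun _ => s)

/-- The regularized model `m_k(s) = T_{f,p}(x,s) + (σ_k/(p+1)!) N(s)^{p+1}`. -/
def model (n p : ℕ) (N : E n → ℝ) (f : E n → ℝ) (σk : ℝ) (x s : E n) : ℝ :=
  Tay n p f x s + σk / ((p + 1).factorial : ℝ) * N s ^ (p + 1)

/-- The ratio `ρ = (f(x) − f(x+s))/(T_{f,p}(x,0) − T_{f,p}(x,s))`. -/
def rho (n p : ℕ) (f : E n → ℝ) (x s : E n) : ℝ :=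
  (f x - f (x + s)) / (Tay n p f x 0 - Tay n p f x s)

/-- An AR1pGN run for `f` with starting point `x0`, initial regularization
parameter `σ0` and parameters `σmin, η1, η2, γ1, γ2, γ3, θ1`. -/
structure AR1Run (n p : ℕ) (N : E n → ℝ) (f : E n → ℝ) (x0 : E n)
    (σmin σ0 η1 η2 γ1 γ2 γ3 θ1 : ℝ) where
  x : ℕ → E n
  s : ℕ → E n
  σ : ℕ → ℝ
  x_init : x 0 = x0
  σ_init : σ 0 = σ0
  s_ne : ∀ k, s k ≠ 0
  σ_pos : ∀ k, 0 < σ k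
  /-- (i) sufficient model decrease `m_k(s_k) ≤ m_k(0)` -/
  descent : ∀ k, model n p N f (σ k) (x k) (s k) ≤ model n p N f (σ k) (x k) 0
  /-- (ii) `‖∇_s T_{f,p}(x_k,s_k)‖_{N,1} ≤ θ1 (σ_k/p!) N(s_k)^p` -/
  term_model : ∀ k,
    dualNorm n N (gradient (fun t => Tay n p f (x k) t) (s k)) ≤
      θ1 * (σ k / (p.factorial : ℝ)) * N (s k) ^ p
  /-- (iii) successful step -/
  succ_step : ∀ k, η1 ≤ rho n p f (x k) (s k) → x (k + 1) = x k + s k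
  /-- (iii) unsuccessful step -/
  fail_step : ∀ k, rho n p f (x k) (s k) < η1 → x (k + 1) = x k
  /-- (iv) very successful update -/
  σ_vsucc : ∀ k, η2 ≤ rho n p f (x k) (s k) →
    max σmin (γ1 * σ k) ≤ σ (k + 1) ∧ σ (k + 1) ≤ σ k
  /-- (iv) successful update -/
  σ_succ : ∀ k, η1 ≤ rho n p f (x k) (s k) → rho n p f (x k) (s k) < η2 →
    σ k ≤ σ (k + 1) ∧ σ (k + 1) ≤ γ2 * σ k
  /-- (iv) unsuccessful update -/
  σ_fail : ∀ k, rho n p f (x k) (s k) < η1 →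
    γ2 * σ k ≤ σ (k + 1) ∧ σ (k + 1) ≤ γ3 * σ k


section Calculus

variable {V : Type*} [NormedAddCommGroup V] [NormedSpace ℝ V] {f : V → ℝ} {p : ℕ}

lemma hasFDerivAt_iteratedFDeriv_apply (hf : ContDiff ℝ p f) {l : ℕ} (hl : l < p)
    (m : Fin l → V) (x : V) :
    HasFDerivAt (fun y => iteratedFDeriv ℝ l f y m)
      ((ContinuousMultilinearMap.apply ℝ (fun _ : Fin l => V) ℝ m).comp
        (fderiv ℝ (iteratedFDeriv ℝ l f) x)) x :=
  (ContinuousMultilinearMap.apply ℝ (fun _ : Fin l => V) ℝ m).hasFDerivAt.comp x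
    (hf.differentiable_iteratedFDeriv (by exact_mod_cast hl) x).hasFDerivAt

lemma fderiv_iteratedFDeriv_apply (hf : ContDiff ℝ p f) {l : ℕ} (hl : l < p)
    (m : Fin l → V) (x v : V) :
    fderiv ℝ (fun y => iteratedFDeriv ℝ l f y m) x v =
      iteratedFDeriv ℝ (l + 1) f x (Fin.cons v m) := by
  rw [(hasFDerivAt_iteratedFDeriv_apply hf hl m x).fderiv]
  simp [iteratedFDeriv_succ_apply_left]

lemma iteratedFDeriv_cons_cons_swap (hf : ContDiff ℝ p f) {l : ℕ} (hl : l + 2 ≤ p)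
    (m : Fin l → V) (x a b : V) :
    iteratedFDeriv ℝ (l + 2) f x (Fin.cons a (Fin.cons b m : Fin (l + 1) → V)) =
      iteratedFDeriv ℝ (l + 2) f x (Fin.cons b (Fin.cons a m : Fin (l + 1) → V)) := by
  have hg : ContDiff ℝ 2 (fun y => iteratedFDeriv ℝ l f y m) :=
    (ContinuousMultilinearMap.apply ℝ (fun _ : Fin l => V) ℝ m).contDiff.comp
      (hf.iteratedFDeriv_right (by rw [add_comm]; exact_mod_cast hl))
  have hd : Differentiable ℝ (fderiv ℝ (fun y => iteratedFDeriv ℝ l f y m)) :=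
    (hg.fderiv_right (m := 1) (by norm_num)).differentiable (by norm_num)
  have key : ∀ a b : V, iteratedFDeriv ℝ (l + 2) f x (Fin.cons a (Fin.cons b m : Fin (l + 1) → V))
      = fderiv ℝ (fderiv ℝ (fun y => iteratedFDeriv ℝ l f y m)) x a b := by
    intro a b
    rw [← fderiv_iteratedFDeriv_apply hf (by omega)]
    simp_rw [← fderiv_iteratedFDeriv_apply hf (show l < p by omega)]
    rw [fderiv_clm_apply (hd x) (differentiableAt_const b)]
    simp
  rw [key, key]
  exact (hg.contDiffAt.isSymmSndFDerivAt (by simp)).eq a b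

lemma iteratedFDeriv_update_const (hf : ContDiff ℝ p f) (s w : V) {l : ℕ} (hl : l + 1 ≤ p)
    (i : Fin (l + 1)) (x : V) :
    iteratedFDeriv ℝ (l + 1) f x (Function.update (fun _ => s) i w) =
      iteratedFDeriv ℝ (l + 1) f x (Fin.cons w fun _ => s) := by
  induction l generalizing x with
  | zero =>
    congr 1
    ext j
    obtain rfl : i = 0 := by omega
    obtain rfl : j = 0 := by omega
    simp
  | succ l ih =>
    have hs : ∀ q : ℕ, (fun _ : Fin (q + 1) => s) = Fin.cons s (fun _ : Fin q => s) := by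
      intro q
      ext j
      refine Fin.cases ?_ (fun j => ?_) j <;> simp
    refine Fin.cases ?_ (fun j => ?_) i
    · rw [hs (l + 1), Fin.update_cons_zero]
    · rw [hs (l + 1), ← Fin.cons_update, ← fderiv_iteratedFDeriv_apply hf (by omega)]
      simp_rw [ih (by omega) j]
      rw [fderiv_iteratedFDeriv_apply hf (by omega), iteratedFDeriv_cons_cons_swap hf (by omega),
        hs l]

lemma hasFDerivAt_iteratedFDeriv_diag {l : ℕ} (x s : V) :
    HasFDerivAt (fun t => iteratedFDeriv ℝ l f x (fun _ => t))
      (((iteratedFDeriv ℝ l f x).linearDeriv fun _ => s).comp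
        (ContinuousLinearMap.pi fun _ => ContinuousLinearMap.id ℝ V)) s :=
  ((iteratedFDeriv ℝ l f x).hasFDerivAt (fun _ => s)).comp s
    (ContinuousLinearMap.pi fun _ => ContinuousLinearMap.id ℝ V).hasFDerivAt

lemma fderiv_iteratedFDeriv_diag (hf : ContDiff ℝ p f) {l : ℕ} (hl : l + 1 ≤ p) (x s w : V) :
    fderiv ℝ (fun t => iteratedFDeriv ℝ (l + 1) f x (fun _ => t)) s w =
      (l + 1) * iteratedFDeriv ℝ (l + 1) f x (Fin.cons w fun _ => s) := by
  rw [(hasFDerivAt_iteratedFDeriv_diag x s).fderiv]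
  simp [ContinuousMultilinearMap.linearDeriv_apply, iteratedFDeriv_update_const hf s w hl]

/-- Taylor's inequality for a chain of successive derivatives. -/
lemma abs_sub_taylor_le {C : ℝ} (p : ℕ) (g : ℕ → ℝ → ℝ)
    (hg : ∀ i < p, ∀ t, HasDerivAt (g i) (g (i + 1) t) t)
    (hC : ∀ t ∈ Set.Icc (0 : ℝ) 1, |g p t| ≤ C) :
    ∀ t ∈ Set.Icc (0 : ℝ) 1,
      |g 0 t - ∑ l ∈ Finset.range p, 1 / (l.factorial : ℝ) * t ^ l * g l 0| ≤
        C * t ^ p / (p.factorial : ℝ) := by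
  induction p generalizing g with
  | zero => simpa using hC
  | succ p ih =>
    have ih' := ih (fun i => g (i + 1)) (fun i hi t => hg (i + 1) (by omega) t) hC
    have hder : ∀ t, HasDerivAt
        (fun t => g 0 t - ∑ l ∈ Finset.range (p + 1), 1 / (l.factorial : ℝ) * t ^ l * g l 0)
        (g 1 t - ∑ l ∈ Finset.range p, 1 / (l.factorial : ℝ) * t ^ l * g (l + 1) 0) t := by
      intro t
      refine (hg 0 (by omega) t).sub ?_
      simp_rw [Finset.sum_range_succ']
      have : HasDerivAt (fun t : ℝ => ∑ l ∈ Finset.range p,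
          1 / ((l + 1).factorial : ℝ) * t ^ (l + 1) * g (l + 1) 0)
          (∑ l ∈ Finset.range p, 1 / (l.factorial : ℝ) * t ^ l * g (l + 1) 0) t := by
        refine HasDerivAt.fun_sum fun l _ => ?_
        refine (((hasDerivAt_pow (l + 1) t).const_mul (1 / ((l + 1).factorial : ℝ))).mul_const
          (g (l + 1) 0)).congr_deriv ?_
        rw [Nat.factorial_succ]
        have : (l.factorial : ℝ) ≠ 0 := by positivity
        push_cast
        field_simp
      simpa using this.add_const (g 0 0)
    have hB : ∀ t, HasDerivAt (fun t : ℝ => C * t ^ (p + 1) / ((p + 1).factorial : ℝ))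
        (C * t ^ p / (p.factorial : ℝ)) t := by
      intro t
      refine (((hasDerivAt_pow (p + 1) t).const_mul C).div_const
        ((p + 1).factorial : ℝ)).congr_deriv ?_
      rw [Nat.factorial_succ]
      have : (p.factorial : ℝ) ≠ 0 := by positivity
      push_cast
      field_simp
    refine image_norm_le_of_norm_deriv_right_le_deriv_boundary
      (fun t _ => (hder t).continuousAt.continuousWithinAt)
      (fun t _ => (hder t).hasDerivWithinAt) ?_ hB
      (fun t ht => ih' t ⟨ht.1, ht.2.le⟩)
    simp [Finset.sum_range_succ']

lemma hasDerivAt_iteratedFDeriv_line (hf : ContDiff ℝ p f) {l : ℕ} (hl : l < p) (x s : V) (t : ℝ) :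
    HasDerivAt (fun t : ℝ => iteratedFDeriv ℝ l f (x + t • s) fun _ => s)
      (iteratedFDeriv ℝ (l + 1) f (x + t • s) fun _ => s) t := by
  have h1 : HasDerivAt (fun t : ℝ => x + t • s) s t := by
    simpa using ((hasDerivAt_id t).smul_const s).const_add x
  have h2 := (hasFDerivAt_iteratedFDeriv_apply hf hl (fun _ => s) (x + t • s)).comp_hasDerivAt t h1
  exact h2

end Calculus

section Norm

variable {n p : ℕ} {N : E n → ℝ}

lemma IsNorm.continuous_s8 (hN : IsNorm n N) : Continuous N := by
  have h := (Seminorm.of N hN.add_le hN.smul).convexOn.continuousOn isOpen_univ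
  exact continuousOn_univ.1 h

lemma IsNorm.nonneg_s8 (hN : IsNorm n N) (x : E n) : 0 ≤ N x :=
  apply_nonneg (Seminorm.of N hN.add_le hN.smul) x

lemma IsNorm.map_zero (hN : IsNorm n N) : N 0 = 0 :=
  _root_.map_zero (Seminorm.of N hN.add_le hN.smul)

lemma IsNorm.pos (hN : IsNorm n N) {x : E n} (hx : x ≠ 0) : 0 < N x :=
  (hN.nonneg_s8 x).lt_of_ne fun h => hx (hN.eq_zero x h.symm)

lemma IsNorm.map_inv_smul (hN : IsNorm n N) {x : E n} (hx : x ≠ 0) : N ((N x)⁻¹ • x) = 1 := by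
  rw [hN.smul, abs_of_pos (inv_pos.2 (hN.pos hx)), inv_mul_cancel₀ (hN.pos hx).ne']

lemma IsNorm.isCompact_sphere (hN : IsNorm n N) : IsCompact {s | N s = 1} := by
  refine Metric.isCompact_of_isClosed_isBounded
    (isClosed_singleton.preimage hN.continuous_s8) ?_
  rcases (Metric.sphere (0 : E n) 1).eq_empty_or_nonempty with h0 | h0
  · refine Bornology.IsBounded.subset (Bornology.isBounded_singleton (x := (0 : E n))) fun s hs => ?_
    by_contra hs0
    have : (‖s‖⁻¹ • s) ∈ Metric.sphere (0 : E n) 1 := by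
      simp [norm_smul, inv_mul_cancel₀ (norm_ne_zero_iff.2 hs0)]
    simp [h0] at this
  · obtain ⟨z, hz, hmin⟩ := (_root_.isCompact_sphere (0 : E n) 1).exists_isMinOn h0
      hN.continuous_s8.continuousOn
    have hz0 : z ≠ 0 := by
      rintro rfl
      simp at hz
    refine (Metric.isBounded_closedBall (x := (0 : E n)) (r := (N z)⁻¹)).subset fun s hs => ?_
    have hs : N s = 1 := hs
    rw [mem_closedBall_zero_iff]
    have hs0 : s ≠ 0 := by
      rintro rfl
      rw [hN.map_zero] at hs
      exact zero_ne_one hs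
    have hns := norm_pos_iff.2 hs0
    have h1 : N z ≤ N (‖s‖⁻¹ • s) := hmin (show ‖s‖⁻¹ • s ∈ Metric.sphere (0 : E n) 1 by
      simp [norm_smul, inv_mul_cancel₀ hns.ne'])
    rw [hN.smul, hs, abs_of_pos (inv_pos.2 hns), mul_one] at h1
    rw [← inv_inv ‖s‖]
    exact inv_anti₀ (hN.pos hz0) h1

lemma IsNorm.inner_le_dualNorm (hN : IsNorm n N) (v s : E n) (hs : N s = 1) :
    ⟪v, s⟫ ≤ dualNorm n N v := by
  refine le_csSup ?_ ⟨s, hs, rfl⟩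
  convert hN.isCompact_sphere.bddAbove_image (f := fun s => ⟪v, s⟫) (by fun_prop) using 1
  ext t
  simp [eq_comm]

lemma IsNorm.abs_apply_le (hN : IsNorm n N) (hp : 1 ≤ p)
    (S : ContinuousMultilinearMap ℝ (fun _ : Fin p => E n) ℝ) (s : E n) :
    |S fun _ => s| ≤ tensorNorm n p N S * N s ^ p := by
  rcases eq_or_ne s 0 with rfl | hs
  · rw [S.map_coord_zero (⟨0, hp⟩ : Fin p) rfl, hN.map_zero, zero_pow (by omega)]
    simp
  have h1 : |S fun _ => (N s)⁻¹ • s| ≤ tensorNorm n p N S := by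
    refine le_csSup ?_ ⟨_, hN.map_inv_smul hs, rfl⟩
    convert hN.isCompact_sphere.bddAbove_image (f := fun s => |S fun _ => s|)
      (by fun_prop) using 1
    ext t
    simp [eq_comm]
  rw [S.map_smul_univ (fun _ => (N s)⁻¹) (fun _ => s)] at h1
  have hp := pow_pos (hN.pos hs) p
  simp only [Finset.prod_const, Finset.card_univ, Fintype.card_fin, smul_eq_mul, abs_mul, inv_pow,
    abs_of_pos (inv_pos.2 hp)] at h1
  rwa [inv_mul_le_iff₀ hp, mul_comm] at h1

lemma dualNorm_le (hn : 1 ≤ n) (hN : IsNorm n N) {v : E n} {C : ℝ}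
    (h : ∀ s, N s = 1 → ⟪v, s⟫ ≤ C) : dualNorm n N v ≤ C := by
  have : Nonempty (Fin n) := ⟨⟨0, hn⟩⟩
  obtain ⟨z, hz⟩ := exists_ne (0 : E n)
  refine csSup_le ⟨_, _, hN.map_inv_smul hz, rfl⟩ ?_
  rintro _ ⟨s, hs, rfl⟩
  exact h s hs

end Norm

section TaylorModel

variable {n p : ℕ} {N : E n → ℝ} {f : E n → ℝ} {L : ℝ}

lemma Tay_zero (x : E n) : Tay n p f x 0 = f x := by
  rw [Tay, add_eq_left]
  refine Finset.sum_eq_zero fun l hl => ?_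
  rw [(iteratedFDeriv ℝ l f x).map_coord_zero (⟨0, (Finset.mem_Icc.1 hl).1⟩ : Fin l) rfl, mul_zero]

lemma Tay_eq_sum_range (x : E n) :
    Tay n p f x = fun s => f x + ∑ l ∈ Finset.range p,
      (1 / ((l + 1).factorial : ℝ)) * iteratedFDeriv ℝ (l + 1) f x (fun _ => s) := by
  ext s
  rw [Tay, ← Finset.Ico_add_one_right_eq_Icc, Finset.sum_Ico_eq_sum_range]
  exact congrArg _ (Finset.sum_congr rfl fun l _ => by rw [Nat.add_comm 1 l])

lemma differentiable_Tay (x : E n) : Differentiable ℝ (Tay n p f x) := by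
  rw [Tay_eq_sum_range]
  refine (differentiable_const _).add (Differentiable.fun_sum fun l _ => ?_)
  exact Differentiable.const_mul
    (fun s => (hasFDerivAt_iteratedFDeriv_diag x s).differentiableAt) _

lemma fderiv_Tay (hf : ContDiff ℝ p f) (x s w : E n) :
    fderiv ℝ (Tay n p f x) s w = ∑ l ∈ Finset.range p,
      (1 / (l.factorial : ℝ)) * iteratedFDeriv ℝ (l + 1) f x (Fin.cons w fun _ => s) := by
  have hd : ∀ l : ℕ, DifferentiableAt ℝ (fun t => iteratedFDeriv ℝ l f x (fun _ => t)) s :=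
    fun l => (hasFDerivAt_iteratedFDeriv_diag x s).differentiableAt
  rw [Tay_eq_sum_range, fderiv_const_add, fderiv_fun_sum fun l _ => (hd (l + 1)).const_mul _,
    sum_apply]
  refine Finset.sum_congr rfl fun l hl => ?_
  rw [fderiv_const_mul (hd (l + 1)), smul_apply,
    fderiv_iteratedFDeriv_diag hf (Finset.mem_range.1 hl), smul_eq_mul, Nat.factorial_succ]
  have : (l.factorial : ℝ) ≠ 0 := by positivity
  push_cast
  field_simp

/-- The Taylor remainder of degree `p - 1` at a fixed displacement `s` is Lipschitz in the
base point. -/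
lemma abs_sub_taylorRemainder_le (hN : IsNorm n N) (hp : 1 ≤ p) (hf : ContDiff ℝ p f)
    (hLip : ∀ x y : E n,
      tensorNorm n p N (iteratedFDeriv ℝ p f x - iteratedFDeriv ℝ p f y) ≤ L * N (x - y))
    (s x y : E n) :
    |(f (y + s) - ∑ l ∈ Finset.range p,
        (1 / (l.factorial : ℝ)) * iteratedFDeriv ℝ l f y (fun _ => s)) -
      (f (x + s) - ∑ l ∈ Finset.range p,
        (1 / (l.factorial : ℝ)) * iteratedFDeriv ℝ l f x (fun _ => s))| ≤
      L * N (y - x) * N s ^ p / (p.factorial : ℝ) := by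
  have h := abs_sub_taylor_le (C := L * N (y - x) * N s ^ p) p
    (fun i t => iteratedFDeriv ℝ i f (y + t • s) (fun _ => s) -
      iteratedFDeriv ℝ i f (x + t • s) (fun _ => s))
    (fun i hi t => (hasDerivAt_iteratedFDeriv_line hf hi y s t).sub
      (hasDerivAt_iteratedFDeriv_line hf hi x s t))
    (fun t _ => by
      have h1 := hN.abs_apply_le hp
        (iteratedFDeriv ℝ p f (y + t • s) - iteratedFDeriv ℝ p f (x + t • s)) s
      refine h1.trans (mul_le_mul_of_nonneg_right ?_ (pow_nonneg (hN.nonneg_s8 s) p))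
      simpa using hLip (y + t • s) (x + t • s))
    1 (by simp)
  convert h using 1
  · congr 1
    simp only [one_smul, iteratedFDeriv_zero_apply, zero_smul, add_zero, one_pow, mul_one, mul_sub,
      Finset.sum_sub_distrib]
    ring
  · simp

lemma abs_fderiv_sub_fderiv_Tay_le (hN : IsNorm n N) (hp : 1 ≤ p) (hf : ContDiff ℝ p f)
    (hLip : ∀ x y : E n,
      tensorNorm n p N (iteratedFDeriv ℝ p f x - iteratedFDeriv ℝ p f y) ≤ L * N (x - y))
    (hL : 0 ≤ L) (x s w : E n) :
    |fderiv ℝ f (x + s) w - fderiv ℝ (Tay n p f x) s w| ≤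
      L * N w * N s ^ p / (p.factorial : ℝ) := by
  have hf1 : Differentiable ℝ f := hf.differentiable (by exact_mod_cast (by omega : p ≠ 0))
  have hd : HasFDerivAt (fun y => f (y + s) - ∑ l ∈ Finset.range p,
        (1 / (l.factorial : ℝ)) * iteratedFDeriv ℝ l f y (fun _ => s))
      (fderiv ℝ f (x + s) - ∑ l ∈ Finset.range p, (1 / (l.factorial : ℝ)) •
        (fderiv ℝ (fun y => iteratedFDeriv ℝ l f y (fun _ => s)) x)) x := by
    refine HasFDerivAt.sub ((hasFDerivAt_comp_add_right s).2 (hf1 (x + s)).hasFDerivAt)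
      (HasFDerivAt.fun_sum fun l hl => HasFDerivAt.const_mul ?_ _)
    exact (hasFDerivAt_iteratedFDeriv_apply hf (Finset.mem_range.1 hl) _
      x).differentiableAt.hasFDerivAt
  have hline : HasDerivAt (fun t : ℝ => x + t • w) w 0 := by
    simpa using ((hasDerivAt_id (0 : ℝ)).smul_const w).const_add x
  have hd' := HasFDerivAt.comp_hasDerivAt (0 : ℝ) (f := fun t : ℝ => x + t • w)
    (by simpa only [zero_smul, add_zero] using hd) hline
  have hNw := hN.nonneg_s8 w
  have hNs := hN.nonneg_s8 s
  have hle := hd'.le_of_lip' (C := L * N w * N s ^ p / (p.factorial : ℝ)) (by positivity)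
    (Filter.Eventually.of_forall fun t => by
      have h := abs_sub_taylorRemainder_le hN hp hf hLip s x (x + t • w)
      rw [add_sub_cancel_left, hN.smul] at h
      simp only [Function.comp, zero_smul, add_zero, sub_zero, Real.norm_eq_abs]
      refine h.trans_eq ?_
      ring)
  rw [Real.norm_eq_abs] at hle
  convert hle using 2
  rw [fderiv_Tay hf, sub_apply, sum_apply]
  congr 1
  refine Finset.sum_congr rfl fun l hl => ?_
  rw [smul_apply, fderiv_iteratedFDeriv_apply hf (Finset.mem_range.1 hl),
    smul_eq_mul]

lemma abs_sub_Tay_le (hN : IsNorm n N) (hp : 1 ≤ p) (hf : ContDiff ℝ p f)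
    (hLip : ∀ x y : E n,
      tensorNorm n p N (iteratedFDeriv ℝ p f x - iteratedFDeriv ℝ p f y) ≤ L * N (x - y))
    (hL : 0 ≤ L) (x s : E n) :
    |f (x + s) - Tay n p f x s| ≤ L / ((p + 1).factorial : ℝ) * N s ^ (p + 1) := by
  have hf1 : Differentiable ℝ f := hf.differentiable (by exact_mod_cast (by omega : p ≠ 0))
  have hder : ∀ t : ℝ, HasDerivAt (fun t : ℝ => f (x + t • s) - Tay n p f x (t • s))
      (fderiv ℝ f (x + t • s) s - fderiv ℝ (Tay n p f x) (t • s) s) t := by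
    intro t
    have h0 : HasDerivAt (fun t : ℝ => t • s) s t := by
      simpa using (hasDerivAt_id t).smul_const s
    exact ((hf1 (x + t • s)).hasFDerivAt.comp_hasDerivAt t (h0.const_add x)).sub
      (HasFDerivAt.comp_hasDerivAt t (f := fun t : ℝ => t • s)
        (differentiable_Tay x (t • s)).hasFDerivAt h0)
  have hB : ∀ t, HasDerivAt
      (fun t : ℝ => L * N s ^ (p + 1) / ((p + 1).factorial : ℝ) * t ^ (p + 1))
      (L * N s ^ (p + 1) / (p.factorial : ℝ) * t ^ p) t := by
    intro t
    refine ((hasDerivAt_pow (p + 1) t).const_mul _).congr_deriv ?_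
    rw [Nat.factorial_succ]
    have : (p.factorial : ℝ) ≠ 0 := by positivity
    push_cast
    field_simp
  have h := image_norm_le_of_norm_deriv_right_le_deriv_boundary (a := 0) (b := 1)
    (fun t _ => (hder t).continuousAt.continuousWithinAt)
    (fun t _ => (hder t).hasDerivWithinAt) (by simp [Tay_zero]) hB
    (fun t ht => by
      have h1 := abs_fderiv_sub_fderiv_Tay_le hN hp hf hLip hL x (t • s) s
      rw [hN.smul, abs_of_nonneg ht.1] at h1
      refine h1.trans_eq ?_
      ring) (show (1 : ℝ) ∈ Set.Icc (0 : ℝ) 1 by simp)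
  simp only [one_smul, Real.norm_eq_abs, one_pow, mul_one] at h
  refine h.trans_eq ?_
  ring

lemma dualNorm_gradient_add_le (hn : 1 ≤ n) (hN : IsNorm n N) (hp : 1 ≤ p)
    (hf : ContDiff ℝ p f)
    (hLip : ∀ x y : E n,
      tensorNorm n p N (iteratedFDeriv ℝ p f x - iteratedFDeriv ℝ p f y) ≤ L * N (x - y))
    (hL : 0 ≤ L) (x s : E n) :
    dualNorm n N (gradient f (x + s)) ≤
      dualNorm n N (gradient (Tay n p f x) s) + L / (p.factorial : ℝ) * N s ^ p := by
  refine dualNorm_le hn hN fun w hw => ?_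
  have h1 := hN.inner_le_dualNorm (gradient (Tay n p f x) s) w hw
  have h2 := (le_abs_self _).trans (abs_fderiv_sub_fderiv_Tay_le hN hp hf hLip hL x s w)
  rw [inner_gradient_left] at h1 ⊢
  rw [hw, mul_one, mul_div_right_comm] at h2
  linarith

end TaylorModel

namespace AR1Run

variable {n p : ℕ} {N : E n → ℝ} {f : E n → ℝ} {x0 : E n}
  {L flow σmin σ0 η1 η2 γ1 γ2 γ3 θ1 : ℝ}

lemma model_decrease_le (run : AR1Run n p N f x0 σmin σ0 η1 η2 γ1 γ2 γ3 θ1)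
    (hN : IsNorm n N) (j : ℕ) :
    run.σ j / ((p + 1).factorial : ℝ) * N (run.s j) ^ (p + 1) ≤
      Tay n p f (run.x j) 0 - Tay n p f (run.x j) (run.s j) := by
  have h := run.descent j
  simp only [model, hN.map_zero, ne_eq, Nat.succ_ne_zero, not_false_eq_true, zero_pow,
    mul_zero, add_zero] at h
  linarith

lemma regularization_pos (run : AR1Run n p N f x0 σmin σ0 η1 η2 γ1 γ2 γ3 θ1)
    (hN : IsNorm n N) (j : ℕ) :
    0 < run.σ j / ((p + 1).factorial : ℝ) * N (run.s j) ^ (p + 1) :=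
  mul_pos (div_pos (run.σ_pos j) (by positivity)) (pow_pos (hN.pos (run.s_ne j)) _)

lemma σmin_le (run : AR1Run n p N f x0 σmin σ0 η1 η2 γ1 γ2 γ3 θ1)
    (hσ0 : σmin ≤ σ0) (hγ2 : 1 < γ2) (j : ℕ) : σmin ≤ run.σ j := by
  induction j with
  | zero => rwa [run.σ_init]
  | succ j ih =>
    have hpos := run.σ_pos j
    rcases lt_or_ge (rho n p f (run.x j) (run.s j)) η1 with h1 | h1
    · nlinarith [(run.σ_fail j h1).1]
    · rcases lt_or_ge (rho n p f (run.x j) (run.s j)) η2 with h2 | h2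
      · exact ih.trans (run.σ_succ j h1 h2).1
      · exact (le_max_left _ _).trans (run.σ_vsucc j h2).1

lemma le_rho_of_le_σ (run : AR1Run n p N f x0 σmin σ0 η1 η2 γ1 γ2 γ3 θ1)
    (hN : IsNorm n N) (hp : 1 ≤ p) (hf : ContDiff ℝ p f)
    (hLip : ∀ x y : E n,
      tensorNorm n p N (iteratedFDeriv ℝ p f x - iteratedFDeriv ℝ p f y) ≤ L * N (x - y))
    (hL : 0 ≤ L) (hη2 : η2 < 1) {j : ℕ} (hj : L / (1 - η2) ≤ run.σ j) :
    η2 ≤ rho n p f (run.x j) (run.s j) := by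
  have hdec := run.model_decrease_le hN j
  have hpos := run.regularization_pos hN j
  have herr := (le_abs_self _).trans (abs_sub_Tay_le hN hp hf hLip hL (run.x j) (run.s j))
  rw [div_le_iff₀ (by linarith)] at hj
  have hLσ : L / ((p + 1).factorial : ℝ) * N (run.s j) ^ (p + 1) ≤
      (1 - η2) * (run.σ j / ((p + 1).factorial : ℝ) * N (run.s j) ^ (p + 1)) := by
    have hc : 0 ≤ N (run.s j) ^ (p + 1) / ((p + 1).factorial : ℝ) :=
      div_nonneg (pow_nonneg (hN.nonneg_s8 _) _) (by positivity)
    calc _ = L * (N (run.s j) ^ (p + 1) / ((p + 1).factorial : ℝ)) := by ring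
      _ ≤ run.σ j * (1 - η2) * (N (run.s j) ^ (p + 1) / ((p + 1).factorial : ℝ)) :=
        mul_le_mul_of_nonneg_right hj hc
      _ = _ := by ring
  rw [rho, le_div_iff₀ (hpos.trans_le hdec)]
  rw [Tay_zero] at hdec ⊢
  nlinarith

lemma σ_le_max (run : AR1Run n p N f x0 σmin σ0 η1 η2 γ1 γ2 γ3 θ1)
    (hN : IsNorm n N) (hp : 1 ≤ p) (hf : ContDiff ℝ p f)
    (hLip : ∀ x y : E n,
      tensorNorm n p N (iteratedFDeriv ℝ p f x - iteratedFDeriv ℝ p f y) ≤ L * N (x - y))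
    (hL : 0 ≤ L) (hη2 : η2 < 1) (hγ2 : 1 < γ2) (hγ23 : γ2 < γ3) (j : ℕ) :
    run.σ j ≤ γ3 * max σ0 (L / (1 - η2)) := by
  have hσ0 : 0 < σ0 := run.σ_init ▸ run.σ_pos 0
  induction j with
  | zero =>
    rw [run.σ_init]
    nlinarith [le_max_left σ0 (L / (1 - η2))]
  | succ j ih =>
    have hpos := run.σ_pos j
    rcases lt_or_ge (rho n p f (run.x j) (run.s j)) η2 with h2 | h2
    · have hlt : run.σ j < L / (1 - η2) := by
        by_contra! h
        exact h2.not_ge (run.le_rho_of_le_σ hN hp hf hLip hL hη2 h)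
      have hstep : run.σ (j + 1) ≤ γ3 * run.σ j := by
        rcases lt_or_ge (rho n p f (run.x j) (run.s j)) η1 with h1 | h1
        · exact (run.σ_fail j h1).2
        · nlinarith [(run.σ_succ j h1 h2).2]
      refine hstep.trans (mul_le_mul_of_nonneg_left ?_ (by linarith))
      exact hlt.le.trans (le_max_right _ _)
    · exact (run.σ_vsucc j h2).2.trans ih

/-- A lower bound on the decrease at successful iterations bounds their number. -/
lemma card_successful_mul_le (run : AR1Run n p N f x0 σmin σ0 η1 η2 γ1 γ2 γ3 θ1)
    (hflow : ∀ x, flow ≤ f x) {a : ℝ} (k : ℕ)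
    (ha : ∀ j ≤ k, η1 ≤ rho n p f (run.x j) (run.s j) →
      a ≤ f (run.x j) - f (run.x (j + 1))) :
    (((Finset.range (k + 1)).filter
      (fun j => η1 ≤ rho n p f (run.x j) (run.s j))).card : ℝ) * a ≤ f x0 - flow := by
  calc _ = ∑ j ∈ (Finset.range (k + 1)).filter
        (fun j => η1 ≤ rho n p f (run.x j) (run.s j)), a := by simp
    _ ≤ ∑ j ∈ (Finset.range (k + 1)).filter
        (fun j => η1 ≤ rho n p f (run.x j) (run.s j)), (f (run.x j) - f (run.x (j + 1))) := by
      refine Finset.sum_le_sum fun j hj => ?_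
      rw [Finset.mem_filter, Finset.mem_range] at hj
      exact ha j (by omega) hj.2
    _ = ∑ j ∈ Finset.range (k + 1), (f (run.x j) - f (run.x (j + 1))) := by
      refine Finset.sum_filter_of_ne fun j _ hj => ?_
      by_contra! h
      exact hj (by rw [run.fail_step j h, sub_self])
    _ = f (run.x 0) - f (run.x (k + 1)) := Finset.sum_range_sub' (fun j => f (run.x j)) _
    _ ≤ f x0 - flow := by
      rw [run.x_init]
      linarith [hflow (run.x (k + 1))]

lemma successful_decrease (run : AR1Run n p N f x0 σmin σ0 η1 η2 γ1 γ2 γ3 θ1)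
    (hn : 1 ≤ n) (hN : IsNorm n N) (hp : 1 ≤ p) (hf : ContDiff ℝ p f)
    (hLip : ∀ x y : E n,
      tensorNorm n p N (iteratedFDeriv ℝ p f x - iteratedFDeriv ℝ p f y) ≤ L * N (x - y))
    (hL : 0 ≤ L) (hσmin : 0 < σmin) (hσ0 : σmin ≤ σ0) (hη1 : 0 < η1) (hη2 : η2 < 1)
    (hγ2 : 1 < γ2) (hγ23 : γ2 < γ3) (hθ1 : 1 < θ1) {ε1 : ℝ} (hε1 : 0 < ε1) {j : ℕ}
    (hgrad : ε1 < dualNorm n N (gradient f (run.x (j + 1))))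
    (hsucc : η1 ≤ rho n p f (run.x j) (run.s j)) :
    η1 * σmin / ((p + 1).factorial : ℝ) *
      (ε1 ^ (((p : ℝ) + 1) / p) /
        ((L + θ1 * (γ3 * max σ0 (L / (1 - η2)))) / (p.factorial : ℝ)) ^ (((p : ℝ) + 1) / p)) ≤
      f (run.x j) - f (run.x (j + 1)) := by
  set K := (L + θ1 * (γ3 * max σ0 (L / (1 - η2)))) / (p.factorial : ℝ) with hK
  have hNs := hN.pos (run.s_ne j)
  have hmax := run.σ_le_max hN hp hf hLip hL hη2 hγ2 hγ23 j
  have hKpos : 0 < K :=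
    div_pos (add_pos_of_nonneg_of_pos hL (mul_pos (by linarith) ((run.σ_pos j).trans_le hmax)))
      (by positivity)
  have hgrowth : ε1 ≤ K * N (run.s j) ^ p := by
    rw [run.succ_step j hsucc] at hgrad
    have h1 := dualNorm_gradient_add_le hn hN hp hf hLip hL (run.x j) (run.s j)
    have h2 := run.term_model j
    have h3 : θ1 * (run.σ j / (p.factorial : ℝ)) * N (run.s j) ^ p ≤
        θ1 * (γ3 * max σ0 (L / (1 - η2)) / (p.factorial : ℝ)) * N (run.s j) ^ p := by
      gcongr
    refine (hgrad.le.trans (h1.trans (add_le_add_left (h2.trans h3) _))).trans_eq ?_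
    rw [hK]
    ring
  have hp0 : (p : ℝ) ≠ 0 := by exact_mod_cast (by omega : p ≠ 0)
  have hpow : ε1 ^ (((p : ℝ) + 1) / p) / K ^ (((p : ℝ) + 1) / p) ≤ N (run.s j) ^ (p + 1) := by
    rw [div_le_iff₀ (Real.rpow_pos_of_pos hKpos _)]
    refine (Real.rpow_le_rpow hε1.le hgrowth (by positivity)).trans_eq ?_
    rw [Real.mul_rpow hKpos.le (by positivity), ← Real.rpow_natCast (N (run.s j)) p,
      ← Real.rpow_mul hNs.le, mul_div_cancel₀ _ hp0, mul_comm,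
      ← Real.rpow_natCast (N (run.s j)) (p + 1)]
    push_cast
    rfl
  have hdec := run.model_decrease_le hN j
  have hpos := run.regularization_pos hN j
  have hactual := hsucc
  rw [rho, le_div_iff₀ (hpos.trans_le hdec), ← run.succ_step j hsucc] at hactual
  refine le_trans ?_ hactual
  have hmin := run.σmin_le hσ0 hγ2 j
  calc _ ≤ η1 * σmin / ((p + 1).factorial : ℝ) * N (run.s j) ^ (p + 1) := by gcongr
    _ ≤ η1 * run.σ j / ((p + 1).factorial : ℝ) * N (run.s j) ^ (p + 1) := by gcongr
    _ = η1 * (run.σ j / ((p + 1).factorial : ℝ) * N (run.s j) ^ (p + 1)) := by ring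
    _ ≤ _ := by gcongr

end AR1Run

/-- evaluation complexity of AR1pGN: if AS.1 and AS.2 hold and the
termination test fails up to iteration `k+1`, then the number of successful
iterations among `{0,…,k}` is at most
`((p+1)!/(η1 σmin)) ((L + θ1 σmax)/p!)^{(p+1)/p} (f(x0) − f_low) ε1^{−(p+1)/p}`. -/
theorem stmt8 {n p : ℕ} (hn : 1 ≤ n) (hp : 1 ≤ p) (N : E n → ℝ) (hN : IsNorm n N)
    (f : E n → ℝ) (hf : ContDiff ℝ p f) (L : ℝ) (hL : 0 ≤ L)
    (hLip : ∀ x y : E n,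
      tensorNorm n p N (iteratedFDeriv ℝ p f x - iteratedFDeriv ℝ p f y) ≤ L * N (x - y))
    (flow : ℝ) (hflow : ∀ x, flow ≤ f x)
    (x0 : E n) (σmin σ0 η1 η2 γ1 γ2 γ3 θ1 : ℝ)
    (hσmin : 0 < σmin) (hσ0 : σmin ≤ σ0)
    (hη1 : 0 < η1) (hη12 : η1 ≤ η2) (hη2 : η2 < 1)
    (hγ1 : 0 < γ1) (hγ11 : γ1 < 1) (hγ2 : 1 < γ2) (hγ23 : γ2 < γ3) (hθ1 : 1 < θ1)
    (run : AR1Run n p N f x0 σmin σ0 η1 η2 γ1 γ2 γ3 θ1)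
    (ε1 : ℝ) (hε1 : 0 < ε1) (hε1' : ε1 ≤ 1) (k : ℕ)
    (hterm : ∀ j ≤ k + 1, ε1 < dualNorm n N (gradient f (run.x j))) :
    (((Finset.range (k + 1)).filter
        (fun j => η1 ≤ rho n p f (run.x j) (run.s j))).card : ℝ) ≤
      (((p + 1).factorial : ℝ) / (η1 * σmin)) *
        ((L + θ1 * (γ3 * max σ0 (L / (1 - η2)))) / (p.factorial : ℝ)) ^
          (((p : ℝ) + 1) / (p : ℝ)) *
        (f x0 - flow) * ε1 ^ (-(((p : ℝ) + 1) / (p : ℝ))) := by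
  have hmax := run.σ_le_max hN hp hf hLip hL hη2 hγ2 hγ23 0
  have hK : 0 < (L + θ1 * (γ3 * max σ0 (L / (1 - η2)))) / (p.factorial : ℝ) :=
    div_pos (add_pos_of_nonneg_of_pos hL (mul_pos (by linarith) ((run.σ_pos 0).trans_le hmax)))
      (by positivity)
  have hcard := run.card_successful_mul_le hflow k fun j hj hsucc =>
    run.successful_decrease hn hN hp hf hLip hL hσmin hσ0 hη1 hη2 hγ2 hγ23 hθ1 hε1
      (hterm (j + 1) (by omega)) hsucc
  have hε := Real.rpow_pos_of_pos hε1 (((p : ℝ) + 1) / p)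
  have hKq := Real.rpow_pos_of_pos hK (((p : ℝ) + 1) / p)
  rw [← le_div_iff₀ (by positivity)] at hcard
  refine hcard.trans_eq ?_
  rw [Real.rpow_neg hε1.le]
  field_simp
end
end
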